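/- Suppose A₀ and A₁ are jointly definite, i.e., there exist μ₀, μ₁ ∈ ℝ such that μ₀A₀ + μ₁A₁ is positive definite. Then every local-nonglobal minimizer of (GTRE) is a strict local minimizer, and every local-nonglobal minimizer of (GTR) is a strict local minimizer (i.e., neither problem has a nonstrict local-nonglobal minimizer). -/

import Mathlib

open Matrix Finset

/-- Euclidean norm of a vector in `Fin n → ℝ`. -/
noncomputable def euclNorm {n : ℕ} (x : Fin n → ℝ) : ℝ := Real.sqrt (x ⬝ᵥ x)

/-- Objective `f₀(x) = xᵀA₀x + 2b₀ᵀx`. -/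
noncomputable def qf0 {n : ℕ} (A0 : Matrix (Fin n) (Fin n) ℝ) (b0 : Fin n → ℝ)
    (x : Fin n → ℝ) : ℝ := x ⬝ᵥ A0.mulVec x + 2 * (b0 ⬝ᵥ x)

/-- Constraint `f₁(x) = xᵀA₁x + 2b₁ᵀx + c₁`. -/
noncomputable def qf1 {n : ℕ} (A1 : Matrix (Fin n) (Fin n) ℝ) (b1 : Fin n → ℝ) (c1 : ℝ)
    (x : Fin n → ℝ) : ℝ := x ⬝ᵥ A1.mulVec x + 2 * (b1 ⬝ᵥ x) + c1

/-- Local minimizer of (GTRE): feasible, and locally optimal among feasible points. -/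
def IsLocalMinGTRE {n : ℕ} (A0 A1 : Matrix (Fin n) (Fin n) ℝ) (b0 b1 : Fin n → ℝ) (c1 : ℝ)
    (xs : Fin n → ℝ) : Prop :=
  qf1 A1 b1 c1 xs = 0 ∧ ∃ δ > (0:ℝ), ∀ x : Fin n → ℝ,
    qf1 A1 b1 c1 x = 0 → euclNorm (x - xs) < δ → qf0 A0 b0 xs ≤ qf0 A0 b0 x

/-- Global minimizer of (GTRE). -/
def IsGlobalMinGTRE {n : ℕ} (A0 A1 : Matrix (Fin n) (Fin n) ℝ) (b0 b1 : Fin n → ℝ) (c1 : ℝ)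
    (xs : Fin n → ℝ) : Prop :=
  qf1 A1 b1 c1 xs = 0 ∧ ∀ x : Fin n → ℝ, qf1 A1 b1 c1 x = 0 → qf0 A0 b0 xs ≤ qf0 A0 b0 x

/-- Local-nonglobal minimizer of (GTRE). -/
def IsLNGMinGTRE {n : ℕ} (A0 A1 : Matrix (Fin n) (Fin n) ℝ) (b0 b1 : Fin n → ℝ) (c1 : ℝ)
    (xs : Fin n → ℝ) : Prop :=
  IsLocalMinGTRE A0 A1 b0 b1 c1 xs ∧ ¬ IsGlobalMinGTRE A0 A1 b0 b1 c1 xs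

/-- Strict local minimizer of (GTRE). -/
def IsStrictLocalMinGTRE {n : ℕ} (A0 A1 : Matrix (Fin n) (Fin n) ℝ) (b0 b1 : Fin n → ℝ)
    (c1 : ℝ) (xs : Fin n → ℝ) : Prop :=
  qf1 A1 b1 c1 xs = 0 ∧ ∃ δ > (0:ℝ), ∀ x : Fin n → ℝ,
    qf1 A1 b1 c1 x = 0 → x ≠ xs → euclNorm (x - xs) < δ → qf0 A0 b0 xs < qf0 A0 b0 x

/-- Strict local-nonglobal minimizer of (GTRE). -/
def IsStrictLNGMinGTRE {n : ℕ} (A0 A1 : Matrix (Fin n) (Fin n) ℝ) (b0 b1 : Fin n → ℝ)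
    (c1 : ℝ) (xs : Fin n → ℝ) : Prop :=
  IsStrictLocalMinGTRE A0 A1 b0 b1 c1 xs ∧ ¬ IsGlobalMinGTRE A0 A1 b0 b1 c1 xs

/-- Local minimizer of (GTR). -/
def IsLocalMinGTR {n : ℕ} (A0 A1 : Matrix (Fin n) (Fin n) ℝ) (b0 b1 : Fin n → ℝ) (c1 : ℝ)
    (xs : Fin n → ℝ) : Prop :=
  qf1 A1 b1 c1 xs ≤ 0 ∧ ∃ δ > (0:ℝ), ∀ x : Fin n → ℝ,
    qf1 A1 b1 c1 x ≤ 0 → euclNorm (x - xs) < δ → qf0 A0 b0 xs ≤ qf0 A0 b0 x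

/-- Global minimizer of (GTR). -/
def IsGlobalMinGTR {n : ℕ} (A0 A1 : Matrix (Fin n) (Fin n) ℝ) (b0 b1 : Fin n → ℝ) (c1 : ℝ)
    (xs : Fin n → ℝ) : Prop :=
  qf1 A1 b1 c1 xs ≤ 0 ∧ ∀ x : Fin n → ℝ, qf1 A1 b1 c1 x ≤ 0 → qf0 A0 b0 xs ≤ qf0 A0 b0 x

/-- Local-nonglobal minimizer of (GTR). -/
def IsLNGMinGTR {n : ℕ} (A0 A1 : Matrix (Fin n) (Fin n) ℝ) (b0 b1 : Fin n → ℝ) (c1 : ℝ)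
    (xs : Fin n → ℝ) : Prop :=
  IsLocalMinGTR A0 A1 b0 b1 c1 xs ∧ ¬ IsGlobalMinGTR A0 A1 b0 b1 c1 xs

/-- Strict local minimizer of (GTR). -/
def IsStrictLocalMinGTR {n : ℕ} (A0 A1 : Matrix (Fin n) (Fin n) ℝ) (b0 b1 : Fin n → ℝ)
    (c1 : ℝ) (xs : Fin n → ℝ) : Prop :=
  qf1 A1 b1 c1 xs ≤ 0 ∧ ∃ δ > (0:ℝ), ∀ x : Fin n → ℝ,
    qf1 A1 b1 c1 x ≤ 0 → x ≠ xs → euclNorm (x - xs) < δ → qf0 A0 b0 xs < qf0 A0 b0 x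

/-- Strict local-nonglobal minimizer of (GTR). -/
def IsStrictLNGMinGTR {n : ℕ} (A0 A1 : Matrix (Fin n) (Fin n) ℝ) (b0 b1 : Fin n → ℝ)
    (c1 : ℝ) (xs : Fin n → ℝ) : Prop :=
  IsStrictLocalMinGTR A0 A1 b0 b1 c1 xs ∧ ¬ IsGlobalMinGTR A0 A1 b0 b1 c1 xs

section QuadraticFunctions

open Filter Topology

variable {n : ℕ} {A A0 A1 M : Matrix (Fin n) (Fin n) ℝ} {g g0 g1 : Fin n → ℝ}

lemma Matrix.IsSymm.dotProduct_mulVec_comm (hA : A.IsSymm) (x y : Fin n → ℝ) :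
    x ⬝ᵥ A *ᵥ y = y ⬝ᵥ A *ᵥ x := by
  rw [dotProduct_mulVec, ← mulVec_transpose, hA.eq, dotProduct_comm]

lemma Matrix.IsSymm.dotProduct_mulVec_add_smul (hA : A.IsSymm) (x y : Fin n → ℝ) (t : ℝ) :
    (x + t • y) ⬝ᵥ A *ᵥ (x + t • y) =
      x ⬝ᵥ A *ᵥ x + 2 * t * (x ⬝ᵥ A *ᵥ y) + t ^ 2 * (y ⬝ᵥ A *ᵥ y) := by
  have h := hA.dotProduct_mulVec_comm x y
  simp only [mulVec_add, mulVec_smul, add_dotProduct, dotProduct_add, smul_dotProduct,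
    dotProduct_smul, smul_eq_mul]
  rw [← h]
  ring

lemma dotProduct_mulVec_smul_smul (A : Matrix (Fin n) (Fin n) ℝ) (t : ℝ) (x : Fin n → ℝ) :
    (t • x) ⬝ᵥ A *ᵥ (t • x) = t ^ 2 * (x ⬝ᵥ A *ᵥ x) := by
  simp only [mulVec_smul, smul_dotProduct, dotProduct_smul, smul_eq_mul]
  ring

lemma qf0_smul (A : Matrix (Fin n) (Fin n) ℝ) (g x : Fin n → ℝ) (t : ℝ) :
    qf0 A g (t • x) = t ^ 2 * (x ⬝ᵥ A *ᵥ x) + 2 * t * (g ⬝ᵥ x) := by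
  rw [qf0, dotProduct_mulVec_smul_smul, dotProduct_smul, smul_eq_mul]
  ring

lemma qf0_add (hA : A.IsSymm) (g x y : Fin n → ℝ) :
    qf0 A g (x + y) = qf0 A g x + qf0 A (A *ᵥ x + g) y := by
  have h := hA.dotProduct_mulVec_add_smul x y 1
  rw [one_smul, hA.dotProduct_mulVec_comm x y, dotProduct_comm y] at h
  have h' : (A *ᵥ x) ⬝ᵥ y = x ⬝ᵥ A *ᵥ y := by
    rw [hA.dotProduct_mulVec_comm, dotProduct_comm]
  have h'' := dotProduct_comm y (A *ᵥ x)
  simp only [qf0, h, dotProduct_add, add_dotProduct]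
  ring

lemma qf0_neg (A : Matrix (Fin n) (Fin n) ℝ) (g x : Fin n → ℝ) :
    qf0 (-A) (-g) x = -qf0 A g x := by
  simp only [qf0, neg_mulVec, dotProduct_neg, neg_dotProduct]
  ring

/-- The Lagrangian identity: along a multiplier, the objective is a quadratic form minus a multiple
of the constraint. -/
lemma qf0_eq_of_multiplier {l : ℝ} (hg : g0 = -(l • g1)) (x : Fin n → ℝ) :
    qf0 A0 g0 x = x ⬝ᵥ (A0 + l • A1) *ᵥ x - l * qf0 A1 g1 x := by
  simp only [qf0, hg, add_mulVec, smul_mulVec, dotProduct_add, dotProduct_smul, smul_eq_mul,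
    neg_dotProduct, smul_dotProduct]
  ring

lemma continuous_qf0 (A : Matrix (Fin n) (Fin n) ℝ) (g : Fin n → ℝ) : Continuous (qf0 A g) := by
  unfold qf0
  fun_prop

lemma contDiff_qf0 (A : Matrix (Fin n) (Fin n) ℝ) (g : Fin n → ℝ) : ContDiff ℝ 1 (qf0 A g) := by
  unfold qf0 mulVec dotProduct
  fun_prop

lemma fderiv_qf0_zero_apply (A : Matrix (Fin n) (Fin n) ℝ) (g u : Fin n → ℝ) :
    fderiv ℝ (qf0 A g) 0 u = 2 * (g ⬝ᵥ u) := by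
  have hd : HasFDerivAt (qf0 A g) (fderiv ℝ (qf0 A g) 0) ((0 : ℝ) • u) := by
    rw [zero_smul]
    exact ((contDiff_qf0 A g).differentiable one_ne_zero 0).hasFDerivAt
  have h1 : HasDerivAt (fun t : ℝ => qf0 A g (t • u)) (fderiv ℝ (qf0 A g) 0 u) 0 := by
    have hu : HasDerivAt (fun t : ℝ => t • u) u 0 := by
      simpa using (hasDerivAt_id (0 : ℝ)).smul_const u
    exact hd.comp_hasDerivAt (0 : ℝ) hu
  have h2 : HasDerivAt (fun t : ℝ => qf0 A g (t • u)) (2 * (g ⬝ᵥ u)) 0 := by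
    simp only [qf0_smul]
    have := (((hasDerivAt_id (0 : ℝ)).pow 2).mul_const (u ⬝ᵥ A *ᵥ u)).add
      (((hasDerivAt_id (0 : ℝ)).const_mul 2).mul_const (g ⬝ᵥ u))
    refine (this.congr_deriv (by simp)).congr_of_eventuallyEq (Eventually.of_forall fun t => ?_)
    simp
  exact h1.unique h2

lemma dotProduct_mulVec_ne_zero_of_posDef {a b : ℝ} (h : (a • A0 + b • A1).PosDef)
    {d : Fin n → ℝ} (hd : d ≠ 0) (h1 : d ⬝ᵥ A1 *ᵥ d = 0) (l : ℝ) :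
    d ⬝ᵥ (A0 + l • A1) *ᵥ d ≠ 0 := by
  intro h0
  have h2 := h.dotProduct_mulVec_pos hd
  simp only [star_trivial, add_mulVec, smul_mulVec, dotProduct_add, dotProduct_smul, smul_eq_mul,
    h1, mul_zero, add_zero] at h0 h2
  simp [h0] at h2

/-- A statement holding near the origin holds along every ray for small positive parameters. -/
lemma eventually_smul_of_eventually {p : (Fin n → ℝ) → Prop} (h : ∀ᶠ x in 𝓝 0, p x)
    (u : Fin n → ℝ) : ∀ᶠ t : ℝ in 𝓝[>] 0, p (t • u) := by
  have hc : Tendsto (fun t : ℝ => t • u) (𝓝[>] 0) (𝓝 0) := by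
    have : Continuous (fun t : ℝ => t • u) := by fun_prop
    exact (this.tendsto' 0 0 (zero_smul _ _)).mono_left nhdsWithin_le_nhds
  exact hc.eventually h

/-- A direction of negative curvature can be perturbed off a hyperplane. -/
lemma exists_neg_curvature_of_ne_zero (hg : g ≠ 0) {v : Fin n → ℝ} (hv : v ⬝ᵥ M *ᵥ v < 0) :
    ∃ w, w ⬝ᵥ M *ᵥ w < 0 ∧ g ⬝ᵥ w ≠ 0 := by
  by_cases h : g ⬝ᵥ v = 0
  · have hc : Continuous (fun t : ℝ => (v + t • g) ⬝ᵥ M *ᵥ (v + t • g)) := by fun_prop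
    have ht : ∀ᶠ t : ℝ in 𝓝[>] 0, (v + t • g) ⬝ᵥ M *ᵥ (v + t • g) < 0 :=
      (hc.tendsto' 0 _ (by simp)).mono_left nhdsWithin_le_nhds |>.eventually_lt_const hv
    obtain ⟨t, ht, ht0⟩ := (ht.and self_mem_nhdsWithin).exists
    refine ⟨v + t • g, ht, ?_⟩
    simpa [h] using ⟨ht0.ne', hg⟩
  · exact ⟨v, hv, h⟩

/-- If `xᵀMx` is nonnegative on a quadric `xᵀAx + 2gᵀx = 0` near the origin and some tangent
direction `d` satisfies `dᵀMd ≤ 0`, without being isotropic for both forms, then `M` is positive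
semidefinite. -/
lemma nonneg_of_tangent_direction (hM : M.IsSymm) (hg : g ≠ 0)
    (hloc : ∀ᶠ x in 𝓝 0, qf0 A g x = 0 → 0 ≤ x ⬝ᵥ M *ᵥ x)
    {d : Fin n → ℝ} (hgd : g ⬝ᵥ d = 0) (hd : d ⬝ᵥ M *ᵥ d ≤ 0)
    (hiso : d ⬝ᵥ A *ᵥ d = 0 → d ⬝ᵥ M *ᵥ d ≠ 0) (v : Fin n → ℝ) :
    0 ≤ v ⬝ᵥ M *ᵥ v := by
  by_contra! hv
  by_cases hq : d ⬝ᵥ A *ᵥ d = 0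
  · obtain ⟨t, ht, ht0⟩ :=
      ((eventually_smul_of_eventually hloc d).and self_mem_nhdsWithin).exists
    rw [qf0_smul, dotProduct_mulVec_smul_smul, hq, hgd] at ht
    have ht0 : (0 : ℝ) < t := ht0
    have := mul_neg_of_pos_of_neg (pow_pos ht0 2) (lt_of_le_of_ne hd (hiso hq))
    linarith [ht (by ring)]
  obtain ⟨w, hw, hgw, hdw⟩ : ∃ w, w ⬝ᵥ M *ᵥ w < 0 ∧ g ⬝ᵥ w ≠ 0 ∧ d ⬝ᵥ M *ᵥ w ≤ 0 := by
    obtain ⟨w, hw, hgw⟩ := exists_neg_curvature_of_ne_zero hg hv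
    rcases le_total (d ⬝ᵥ M *ᵥ w) 0 with h | h
    · exact ⟨w, hw, hgw, h⟩
    · refine ⟨-w, ?_, ?_, ?_⟩ <;> simpa [mulVec_neg]
  set D : ℝ → ℝ := fun t => (d + t • w) ⬝ᵥ A *ᵥ (d + t • w) with hDdef
  have hD : Tendsto D (𝓝 0) (𝓝 (d ⬝ᵥ A *ᵥ d)) := by
    have : Continuous D := by fun_prop
    exact this.tendsto' 0 _ (by simp [hDdef])
  set s : ℝ → ℝ := fun t => -(2 * t * (g ⬝ᵥ w)) / D t with hsdef
  have hs : Tendsto s (𝓝 0) (𝓝 0) := by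
    have h : Tendsto (fun t : ℝ => -(2 * t * (g ⬝ᵥ w))) (𝓝 0) (𝓝 0) := by
      have : Continuous (fun t : ℝ => -(2 * t * (g ⬝ᵥ w))) := by fun_prop
      exact this.tendsto' 0 _ (by simp)
    have h' := h.div hD hq
    rwa [zero_div] at h'
  have hx : Tendsto (fun t => s t • (d + t • w)) (𝓝[>] 0) (𝓝 0) := by
    have h : Tendsto (fun t : ℝ => d + t • w) (𝓝 0) (𝓝 d) := by
      have : Continuous (fun t : ℝ => d + t • w) := by fun_prop
      exact this.tendsto' 0 _ (by simp)
    simpa using (hs.smul h).mono_left nhdsWithin_le_nhds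
  obtain ⟨t, ⟨ht, hDt⟩, ht0⟩ := (((hx.eventually hloc).and
    ((hD.mono_left nhdsWithin_le_nhds).eventually_ne hq)).and self_mem_nhdsWithin).exists
  have ht0 : (0 : ℝ) < t := ht0
  have hst : s t ≠ 0 := by
    simp only [hsdef]
    exact div_ne_zero (neg_ne_zero.2 (by positivity)) hDt
  have hsD : s t * D t = -(2 * t * (g ⬝ᵥ w)) := div_mul_cancel₀ _ hDt
  have hfeas : qf0 A g (s t • (d + t • w)) = 0 := by
    rw [qf0_smul, dotProduct_add, dotProduct_smul, hgd, smul_eq_mul]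
    linear_combination s t * hsD
  have hval := ht hfeas
  rw [dotProduct_mulVec_smul_smul, hM.dotProduct_mulVec_add_smul] at hval
  have h1 : 0 < s t ^ 2 := by positivity
  have h2 : t ^ 2 * (w ⬝ᵥ M *ᵥ w) < 0 := mul_neg_of_pos_of_neg (by positivity) hw
  have h3 : t * (d ⬝ᵥ M *ᵥ w) ≤ 0 := mul_nonpos_of_nonneg_of_nonpos ht0.le hdw
  nlinarith

/-- Lagrange multipliers for a regular point of a quadric. -/
lemma exists_multiplier (hg1 : g1 ≠ 0)
    (hloc : ∀ᶠ x in 𝓝 0, qf0 A1 g1 x = 0 → 0 ≤ qf0 A0 g0 x) :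
    ∃ l : ℝ, g0 = -(l • g1) := by
  have hzero : ∀ (A : Matrix (Fin n) (Fin n) ℝ) (g : Fin n → ℝ), qf0 A g 0 = 0 := by simp [qf0]
  have hext : IsLocalExtrOn (qf0 A0 g0) {x | qf0 A1 g1 x = qf0 A1 g1 0} 0 := by
    left
    refine eventually_nhdsWithin_iff.2 ?_
    filter_upwards [hloc] with x hx hx'
    rw [hzero]
    exact hx (by simpa [hzero] using hx')
  have hder : ∀ (A : Matrix (Fin n) (Fin n) ℝ) (g : Fin n → ℝ),
      HasStrictFDerivAt (qf0 A g) (fderiv ℝ (qf0 A g) 0) 0 := fun A g =>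
    (contDiff_qf0 A g).contDiffAt.hasStrictFDerivAt one_ne_zero
  obtain ⟨a, b, hab, h⟩ :=
    hext.exists_multipliers_of_hasStrictFDerivAt_1d (hder A1 g1) (hder A0 g0)
  have h' : a • g1 + b • g0 = 0 := by
    refine dotProduct_eq_zero _ fun u => ?_
    have hu := congrArg (fun L => L u) h
    simp [fderiv_qf0_zero_apply] at hu
    simp only [add_dotProduct, smul_dotProduct, smul_eq_mul]
    linarith
  have hb : b ≠ 0 := by
    rintro rfl
    have ha : a ≠ 0 := by simpa using hab
    simp [ha, hg1] at h'
  refine ⟨a / b, ?_⟩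
  have h2 : b • g0 = -(a • g1) := eq_neg_of_add_eq_zero_right h'
  rw [← inv_smul_smul₀ hb g0, h2, smul_neg, smul_smul, div_eq_inv_mul]

/-- Limiting directions of a sequence of points tending to the origin along which three quadratic
functions are nonpositive. -/
lemma exists_limit_direction (A B C : Matrix (Fin n) (Fin n) ℝ) (a b : Fin n → ℝ)
    (h : ∃ᶠ x in 𝓝[≠] 0, qf0 A a x ≤ 0 ∧ qf0 B b x ≤ 0 ∧ x ⬝ᵥ C *ᵥ x ≤ 0) :
    ∃ d, d ≠ 0 ∧ a ⬝ᵥ d ≤ 0 ∧ b ⬝ᵥ d ≤ 0 ∧ d ⬝ᵥ C *ᵥ d ≤ 0 := by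
  obtain ⟨x, hx, hp⟩ := exists_seq_forall_of_frequently h
  obtain ⟨hx0, hxne⟩ := tendsto_nhdsWithin_iff.1 hx
  obtain ⟨k, hk⟩ := eventually_atTop.1 hxne
  replace hk : ∀ i, x (i + k) ≠ 0 := fun i => hk _ (Nat.le_add_left _ _)
  set y : ℕ → Fin n → ℝ := fun i => ‖x (i + k)‖⁻¹ • x (i + k) with hy
  have hys : ∀ i, y i ∈ Metric.sphere (0 : Fin n → ℝ) 1 := fun i => by
    simp [hy, norm_smul, hk i]
  obtain ⟨d, hd, φ, hφ, hlim⟩ := (isCompact_sphere (0 : Fin n → ℝ) 1).tendsto_subseq hys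
  set r : ℕ → ℝ := fun i => ‖x (φ i + k)‖ with hr
  have hr0 : Tendsto r atTop (𝓝 0) := by
    have h1 : Tendsto (fun i => φ i + k) atTop atTop :=
      tendsto_atTop_mono (fun i => Nat.le_add_right _ _) hφ.tendsto_atTop
    simpa using (hx0.comp h1).norm
  have hrpos : ∀ i, 0 < r i := fun i => norm_pos_iff.2 (hk _)
  have hxy : ∀ i, x (φ i + k) = r i • (y ∘ φ) i := fun i => by
    simp [hy, hr, smul_smul, hk]
  have hlin : ∀ (E : Matrix (Fin n) (Fin n) ℝ) (e : Fin n → ℝ),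
      (∀ i, qf0 E e (x i) ≤ 0) → e ⬝ᵥ d ≤ 0 := by
    intro E e hE
    have hcE : Tendsto (fun i => r i * ((y ∘ φ) i ⬝ᵥ E *ᵥ (y ∘ φ) i) + 2 * (e ⬝ᵥ (y ∘ φ) i))
        atTop (𝓝 (0 * (d ⬝ᵥ E *ᵥ d) + 2 * (e ⬝ᵥ d))) := by
      have c1 : Continuous fun z : Fin n → ℝ => z ⬝ᵥ E *ᵥ z := by fun_prop
      have c2 : Continuous fun z : Fin n → ℝ => 2 * (e ⬝ᵥ z) := by fun_prop
      exact (hr0.mul ((c1.tendsto d).comp hlim)).add ((c2.tendsto d).comp hlim)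
    have := le_of_tendsto' hcE (b := 0) fun i => by
      have h1 := hE (φ i + k)
      rw [hxy, qf0_smul] at h1
      refine nonpos_of_mul_nonpos_right (a := r i) ?_ (hrpos i)
      linarith
    linarith
  refine ⟨d, ?_, hlin A a fun i => (hp i).1, hlin B b fun i => (hp i).2.1, ?_⟩
  · rintro rfl
    simp at hd
  · have c : Continuous fun z : Fin n → ℝ => z ⬝ᵥ C *ᵥ z := by fun_prop
    refine le_of_tendsto' ((c.tendsto d).comp hlim) fun i => ?_
    have h1 := (hp (φ i + k)).2.2
    rw [hxy, dotProduct_mulVec_smul_smul] at h1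
    exact nonpos_of_mul_nonpos_right h1 (pow_pos (hrpos i) 2)

/-- If the origin is a local minimizer of a quadratic function on a symmetric cone, it is a global one. -/
lemma nonneg_of_cone {p : (Fin n → ℝ) → Prop} (hp : ∀ (t : ℝ) x, p x → p (t • x))
    (hloc : ∀ᶠ x in 𝓝 0, p x → 0 ≤ qf0 A0 g0 x) {x : Fin n → ℝ} (hx : p x) :
    0 ≤ qf0 A0 g0 x := by
  have hneg : p (-x) := by simpa using hp (-1) x hx
  have hray : ∀ u, p u → ∀ᶠ t : ℝ in 𝓝[>] 0, 0 ≤ t * (u ⬝ᵥ A0 *ᵥ u) + 2 * (g0 ⬝ᵥ u) := by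
    intro u hu
    filter_upwards [eventually_smul_of_eventually hloc u, self_mem_nhdsWithin] with t ht ht0
    have h := ht (hp t u hu)
    rw [qf0_smul] at h
    refine nonneg_of_mul_nonneg_right (a := t) ?_ ht0
    linarith
  have hfirst : ∀ u, p u → 0 ≤ g0 ⬝ᵥ u := by
    intro u hu
    have hc : Continuous fun t : ℝ => t * (u ⬝ᵥ A0 *ᵥ u) + 2 * (g0 ⬝ᵥ u) := by fun_prop
    have := ge_of_tendsto ((hc.tendsto 0).mono_left nhdsWithin_le_nhds) (hray u hu)
    linarith
  have h1 := hfirst x hx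
  have h2 : g0 ⬝ᵥ x = 0 := by
    have := hfirst (-x) hneg
    rw [dotProduct_neg] at this
    linarith
  obtain ⟨t, ht, ht0⟩ := ((hray x hx).and self_mem_nhdsWithin).exists
  rw [h2, mul_zero, add_zero] at ht
  rw [qf0, h2, mul_zero, add_zero]
  exact nonneg_of_mul_nonneg_right ht ht0

lemma isGlobalMin_of_not_strict_eq (hA0 : A0.IsSymm) (hA1 : A1.IsSymm) {a b : ℝ}
    (hjoint : (a • A0 + b • A1).PosDef)
    (hloc : ∀ᶠ x in 𝓝 0, qf0 A1 g1 x = 0 → 0 ≤ qf0 A0 g0 x)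
    (hfreq : ∃ᶠ x in 𝓝[≠] 0, qf0 A1 g1 x = 0 ∧ qf0 A0 g0 x ≤ 0)
    {x : Fin n → ℝ} (hx : qf0 A1 g1 x = 0) : 0 ≤ qf0 A0 g0 x := by
  rcases eq_or_ne g1 0 with rfl | hg1
  · refine nonneg_of_cone (p := fun x => qf0 A1 0 x = 0) (fun t x hx => ?_) hloc hx
    rw [qf0_smul]
    simp only [qf0, zero_dotProduct] at hx ⊢
    linear_combination t ^ 2 * hx
  obtain ⟨l, hl⟩ := exists_multiplier hg1 hloc
  obtain ⟨d, hd, h1, h2, h3⟩ := exists_limit_direction A1 (-A1) (A0 + l • A1) g1 (-g1) <|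
    hfreq.mono fun x hx => by
      have h := hx.2
      rw [qf0_eq_of_multiplier (A1 := A1) hl, hx.1] at h
      exact ⟨hx.1.le, by rw [qf0_neg, hx.1, neg_zero], by linarith⟩
  rw [neg_dotProduct] at h2
  have hpsd := nonneg_of_tangent_direction (hA0.add (hA1.smul l)) hg1
    (hloc.mono fun x hx hx1 => by
      have h := hx hx1
      rw [qf0_eq_of_multiplier (A1 := A1) hl, hx1] at h
      linarith) (d := d) (by linarith) h3
    (fun h => dotProduct_mulVec_ne_zero_of_posDef hjoint hd h l) x
  rw [qf0_eq_of_multiplier (A1 := A1) hl, hx]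
  linarith

lemma isGlobalMin_of_not_strict_le (hA0 : A0.IsSymm) (hA1 : A1.IsSymm) {a b : ℝ}
    (hjoint : (a • A0 + b • A1).PosDef)
    (hloc : ∀ᶠ x in 𝓝 0, qf0 A1 g1 x ≤ 0 → 0 ≤ qf0 A0 g0 x)
    (hfreq : ∃ᶠ x in 𝓝[≠] 0, qf0 A1 g1 x ≤ 0 ∧ qf0 A0 g0 x ≤ 0)
    {x : Fin n → ℝ} (hx : qf0 A1 g1 x ≤ 0) : 0 ≤ qf0 A0 g0 x := by
  rcases eq_or_ne g1 0 with rfl | hg1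
  · refine nonneg_of_cone (p := fun x => qf0 A1 0 x ≤ 0) (fun t x hx => ?_) hloc hx
    rw [qf0_smul]
    simp only [qf0, zero_dotProduct, mul_zero, add_zero] at hx ⊢
    exact mul_nonpos_of_nonneg_of_nonpos (sq_nonneg t) hx
  have hloceq : ∀ᶠ x in 𝓝 0, qf0 A1 g1 x = 0 → 0 ≤ qf0 A0 g0 x :=
    hloc.mono fun x hx h => hx h.le
  obtain ⟨l, hl⟩ := exists_multiplier hg1 hloceq
  have hdescent : ∀ u, g1 ⬝ᵥ u < 0 → ∀ᶠ t : ℝ in 𝓝[>] 0,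
      0 ≤ t * (u ⬝ᵥ A0 *ᵥ u) + 2 * (g0 ⬝ᵥ u) := by
    intro u hu
    have hc : Continuous fun t : ℝ => t * (u ⬝ᵥ A1 *ᵥ u) + 2 * (g1 ⬝ᵥ u) := by fun_prop
    have hneg := ((hc.tendsto' 0 (2 * (g1 ⬝ᵥ u)) (by simp)).mono_left
      (nhdsWithin_le_nhds (s := Set.Ioi 0))).eventually_lt_const (u := 0) (by linarith)
    filter_upwards [hneg, eventually_smul_of_eventually hloc u, self_mem_nhdsWithin]
      with t ht h ht0
    have ht0 : (0 : ℝ) < t := ht0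
    rw [qf0_smul, qf0_smul] at h
    refine nonneg_of_mul_nonneg_right (a := t) ?_ ht0
    have h1 := h (by nlinarith)
    linarith
  have hlnn : 0 ≤ l := by
    have hgg : 0 < g1 ⬝ᵥ g1 := by
      have h0 : 0 ≤ g1 ⬝ᵥ g1 := by simpa using dotProduct_self_star_nonneg g1
      exact lt_of_le_of_ne h0 (Ne.symm (by simpa using hg1))
    have hc : Continuous fun t : ℝ => t * ((-g1) ⬝ᵥ A0 *ᵥ (-g1)) + 2 * (g0 ⬝ᵥ (-g1)) := by
      fun_prop
    have h := ge_of_tendsto ((hc.tendsto 0).mono_left nhdsWithin_le_nhds)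
      (hdescent (-g1) (by simpa using hgg))
    simp only [hl, neg_dotProduct, smul_dotProduct, dotProduct_neg, smul_eq_mul] at h
    nlinarith
  suffices hpsd : 0 ≤ x ⬝ᵥ (A0 + l • A1) *ᵥ x by
    rw [qf0_eq_of_multiplier (A1 := A1) hl]
    nlinarith
  rcases hlnn.eq_or_lt with rfl | hlpos
  · by_contra! hneg
    obtain ⟨w, hw, hgw⟩ : ∃ w, w ⬝ᵥ A0 *ᵥ w < 0 ∧ g1 ⬝ᵥ w < 0 := by
      obtain ⟨w, hw, hgw⟩ := exists_neg_curvature_of_ne_zero hg1 hneg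
      rw [zero_smul, add_zero] at hw
      rcases hgw.lt_or_gt with h | h
      · exact ⟨w, hw, h⟩
      · exact ⟨-w, by simpa [mulVec_neg], by simpa⟩
    obtain ⟨t, ht, ht0⟩ := ((hdescent w hgw).and self_mem_nhdsWithin).exists
    have ht0 : (0 : ℝ) < t := ht0
    simp only [hl, zero_smul, neg_zero, zero_dotProduct, mul_zero, add_zero] at ht
    nlinarith
  obtain ⟨d, hd, h1, h2, h3⟩ := exists_limit_direction A1 A0 (A0 + l • A1) g1 g0 <|
    hfreq.mono fun x hx => by
      have h := hx.2
      rw [qf0_eq_of_multiplier (A1 := A1) hl] at h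
      exact ⟨hx.1, hx.2, by nlinarith [hx.1]⟩
  have hgd : g1 ⬝ᵥ d = 0 := by
    simp only [hl, neg_dotProduct, smul_dotProduct, smul_eq_mul] at h2
    nlinarith
  refine nonneg_of_tangent_direction (hA0.add (hA1.smul l)) hg1
    (hloceq.mono fun x hx hx1 => ?_) hgd h3
    (fun h => dotProduct_mulVec_ne_zero_of_posDef hjoint hd h l) x
  have h := hx hx1
  rw [qf0_eq_of_multiplier (A1 := A1) hl, hx1] at h
  linarith

lemma qf1_eq (A : Matrix (Fin n) (Fin n) ℝ) (b : Fin n → ℝ) (c : ℝ) (x : Fin n → ℝ) :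
    qf1 A b c x = qf0 A b x + c := rfl

lemma norm_le_euclNorm (x : Fin n → ℝ) : ‖x‖ ≤ euclNorm x := by
  refine (pi_norm_le_iff_of_nonneg (Real.sqrt_nonneg _)).2 fun i => ?_
  refine Real.le_sqrt_of_sq_le ?_
  rw [Real.norm_eq_abs, sq_abs, sq]
  exact Finset.single_le_sum (f := fun j => x j * x j) (fun j _ => mul_self_nonneg _)
    (Finset.mem_univ i)

lemma eventually_nhds_zero_iff_euclNorm {p : (Fin n → ℝ) → Prop} :
    (∀ᶠ x in 𝓝 0, p x) ↔ ∃ δ > (0 : ℝ), ∀ x, euclNorm x < δ → p x := by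
  constructor
  · intro h
    obtain ⟨δ, hδ, h⟩ := Metric.eventually_nhds_iff.1 h
    exact ⟨δ, hδ, fun x hx => h (by simpa using (norm_le_euclNorm x).trans_lt hx)⟩
  · rintro ⟨δ, hδ, h⟩
    have hc : Continuous (euclNorm (n := n)) := by
      unfold euclNorm
      fun_prop
    exact ((hc.tendsto' 0 0 (by simp [euclNorm])).eventually_lt_const hδ).mono h

/-- Translation of a local statement to the origin. -/
lemma exists_euclNorm_sub_iff {p : (Fin n → ℝ) → Prop} (xs : Fin n → ℝ) :
    (∃ δ > (0 : ℝ), ∀ x, euclNorm (x - xs) < δ → p x) ↔ ∀ᶠ x in 𝓝 0, p (xs + x) := by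
  rw [eventually_nhds_zero_iff_euclNorm]
  refine exists_congr fun δ => and_congr_right fun _ => ⟨fun h x hx => h _ (by simpa), ?_⟩
  intro h x hx
  simpa using h (x - xs) hx

end QuadraticFunctions

theorem stmt10 {n : ℕ} (hn : 1 ≤ n)
    (A0 A1 : Matrix (Fin n) (Fin n) ℝ) (hA0 : A0.IsSymm) (hA1 : A1.IsSymm)
    (b0 b1 : Fin n → ℝ) (c1 : ℝ)
    (hjoint : ∃ μ0 μ1 : ℝ, (μ0 • A0 + μ1 • A1).PosDef) :
    (∀ xs : Fin n → ℝ, IsLNGMinGTRE A0 A1 b0 b1 c1 xs →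
       IsStrictLocalMinGTRE A0 A1 b0 b1 c1 xs) ∧
    (∀ xs : Fin n → ℝ, IsLNGMinGTR A0 A1 b0 b1 c1 xs →
       IsStrictLocalMinGTR A0 A1 b0 b1 c1 xs) := by
  obtain ⟨a, b, hjoint⟩ := hjoint
  have hf0 := qf0_add hA0 b0
  have hf1 := fun x y => (congrArg (· + c1) (qf0_add hA1 b1 x y)).trans (add_right_comm _ _ _)
  simp only [← qf1_eq] at hf1
  constructor
  · rintro xs ⟨⟨hfeas, δ, hδ, hmin⟩, hglob⟩
    refine ⟨hfeas, ?_⟩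
    have hloc := (exists_euclNorm_sub_iff xs).1 ⟨δ, hδ, fun x h1 h2 => hmin x h2 h1⟩
    by_contra hns
    refine hglob ⟨hfeas, fun x hx => ?_⟩
    have hfreq := fun h => hns ((exists_euclNorm_sub_iff xs
      (p := fun x => qf1 A1 b1 c1 x = 0 → x ≠ xs → qf0 A0 b0 xs < qf0 A0 b0 x)).2 h |>.imp
        fun δ h => ⟨h.1, fun x h1 h2 h3 => h.2 x h3 h1 h2⟩)
    simp only [hf0, hf1, hfeas, zero_add, ne_eq, add_eq_left, le_add_iff_nonneg_right,
      lt_add_iff_pos_right] at hloc hfreq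
    obtain ⟨y, rfl⟩ : ∃ y, x = xs + y := ⟨x - xs, by simp⟩
    rw [hf1, hfeas, zero_add] at hx
    rw [hf0, le_add_iff_nonneg_right]
    refine isGlobalMin_of_not_strict_eq hA0 hA1 hjoint hloc (fun h => hfreq ?_) hx
    filter_upwards [eventually_nhdsWithin_iff.1 h] with z hz h1 h2
    by_contra! h3
    exact hz h2 ⟨h1, h3⟩
  · rintro xs ⟨⟨hfeas, δ, hδ, hmin⟩, hglob⟩
    refine ⟨hfeas, ?_⟩
    have hloc := (exists_euclNorm_sub_iff xs).1 ⟨δ, hδ, fun x h1 h2 => hmin x h2 h1⟩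
    by_contra hns
    refine hglob ⟨hfeas, fun x hx => ?_⟩
    have hfreq := fun h => hns ((exists_euclNorm_sub_iff xs
      (p := fun x => qf1 A1 b1 c1 x ≤ 0 → x ≠ xs → qf0 A0 b0 xs < qf0 A0 b0 x)).2 h |>.imp
        fun δ h => ⟨h.1, fun x h1 h2 h3 => h.2 x h3 h1 h2⟩)
    obtain ⟨y, rfl⟩ : ∃ y, x = xs + y := ⟨x - xs, by simp⟩
    rw [hf0, le_add_iff_nonneg_right]
    simp only [hf0, hf1, ne_eq, add_eq_left, le_add_iff_nonneg_right,
      lt_add_iff_pos_right] at hloc hfreq hx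
    rcases hfeas.lt_or_eq with hlt | heq
    · refine nonneg_of_cone (p := fun _ => True) (fun _ _ _ => trivial) ?_ trivial
      have hc := continuous_qf0 A1 (A1 *ᵥ xs + b1)
      filter_upwards [hloc, (hc.tendsto' 0 0 (by simp [qf0])).eventually_lt_const
        (neg_pos.2 hlt)] with z hz h1 _
      exact hz (by linarith)
    simp only [heq, zero_add] at hloc hfreq hx
    refine isGlobalMin_of_not_strict_le hA0 hA1 hjoint hloc (fun h => hfreq ?_) hx
    filter_upwards [eventually_nhdsWithin_iff.1 h] with z hz h1 h2
    by_contra! h3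
    exact hz h2 ⟨h1, h3⟩
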